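/- arXiv:2509.22868 — 4 statements merged into one kernel-verified Lean document; each statement's English description precedes it below -/
import Mathlib

section
/- Fix an integer N ≥ 1, a probability vector p on {1,…,N} with p(v) > 0 for all v, an integer N_l ≥ 1, and a function q : {1,…,N} → (0,1]. Let M_p ∈ ℝ^{N×N} have entries M_p(v,v) = 1 + (1 − p(v))/(p(v) N_l) and M_p(v,v') = 1 − 1/N_l for v ≠ v', and let M_q ∈ ℝ^{N×N} have diagonal entries 1/q(v) and off-diagonal entries 1. Then, for every symmetric positive semidefinite real N×N matrix B, both M_p ⊙ B ⪰ B and M_q ⊙ B ⪰ B in the Loewner order, where ⊙ denotes the Hadamard (entrywise) product. (Proposition 10, Property (iii).) -/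
open Matrix

/-- If `p` is a probability vector with positive entries, then `diag(1/p)` dominates the all-ones
matrix in the Loewner order. -/
theorem posSemidef_diagonal_inv_sub_one {ι : Type*} [Fintype ι] [DecidableEq ι]
    {p : ι → ℝ} (hp : ∀ v, 0 < p v) (hp1 : ∑ v, p v = 1) :
    (diagonal (fun v => (p v)⁻¹) - Matrix.of fun _ _ : ι => (1 : ℝ)).PosSemidef := by
  refine PosSemidef.of_dotProduct_mulVec_nonneg
    ((isHermitian_diagonal _).sub (IsHermitian.ext fun _ _ => by simp)) fun x => ?_
  have cauchy_schwarz : (∑ v, x v) ^ 2 ≤ (∑ v, p v) * ∑ v, (p v)⁻¹ * x v ^ 2 :=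
    Finset.sum_sq_le_sum_mul_sum_of_sq_le_mul _ (fun v _ => (hp v).le)
      (fun v _ => mul_nonneg (inv_nonneg.2 (hp v).le) (sq_nonneg _))
      (fun v _ => (mul_inv_cancel_left₀ (hp v).ne' _).ge)
  have quadratic_form :
      star x ⬝ᵥ ((diagonal (fun v => (p v)⁻¹) - Matrix.of fun _ _ : ι => (1 : ℝ)) *ᵥ x)
        = ∑ v, (p v)⁻¹ * x v ^ 2 - (∑ v, x v) ^ 2 := by
    rw [sub_mulVec, dotProduct_sub]
    congr 1
    · simp only [dotProduct, mulVec_diagonal, Pi.star_apply, star_trivial]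
      exact Finset.sum_congr rfl fun v _ => by ring
    · simp [dotProduct, mulVec, ← Finset.sum_mul, sq]
  rw [quadratic_form]
  rw [hp1, one_mul] at cauchy_schwarz
  exact sub_nonneg.2 cauchy_schwarz

/-- If `M` dominates the all-ones matrix, then Hadamard multiplication by `M` dominates the identity
on positive semidefinite matrices. -/
theorem posSemidef_hadamard_sub_self {ι : Type*} [Finite ι] {M B : Matrix ι ι ℝ}
    (hM : (M - Matrix.of fun _ _ : ι => (1 : ℝ)).PosSemidef) (hB : B.PosSemidef) :
    (M.hadamard B - B).PosSemidef := by
  have factor : M.hadamard B - B = (M - Matrix.of fun _ _ : ι => (1 : ℝ)).hadamard B := by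
    ext v w
    simp [sub_mul]
  rw [factor]
  exact hM.hadamard hB

/-- Proposition 10, Property (iii): for every symmetric PSD matrix `B`,
`M_p ⊙ B ⪰ B` and `M_q ⊙ B ⪰ B` in the Loewner order. -/
theorem masking_hadamard_psd
    (N : ℕ) (hN : 1 ≤ N)
    (p : Fin N → ℝ) (hp : ∀ v, 0 < p v) (hp1 : ∑ v, p v = 1)
    (Nl : ℕ) (hNl : 1 ≤ Nl)
    (q : Fin N → ℝ) (hq : ∀ v, q v ∈ Set.Ioc (0 : ℝ) 1)
    (Mp : Matrix (Fin N) (Fin N) ℝ)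
    (hMp : ∀ v v', Mp v v' =
      if v = v' then 1 + (1 - p v) / (p v * (Nl : ℝ)) else 1 - 1 / (Nl : ℝ))
    (Mq : Matrix (Fin N) (Fin N) ℝ)
    (hMq : ∀ v v', Mq v v' = if v = v' then 1 / q v else 1)
    (B : Matrix (Fin N) (Fin N) ℝ) (hB : B.PosSemidef) :
    (Mp.hadamard B - B).PosSemidef ∧ (Mq.hadamard B - B).PosSemidef := by
  refine ⟨posSemidef_hadamard_sub_self ?_ hB, posSemidef_hadamard_sub_self ?_ hB⟩
  · have hNl0 : (Nl : ℝ) ≠ 0 := by positivity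
    convert (posSemidef_diagonal_inv_sub_one hp hp1).smul
      (inv_nonneg.2 (Nat.cast_nonneg Nl : (0 : ℝ) ≤ Nl)) using 1
    ext v w
    have hpv := (hp v).ne'
    by_cases hvw : v = w
    · subst hvw
      simp only [Matrix.sub_apply, Matrix.smul_apply, hMp, of_apply, diagonal_apply_eq, if_true, smul_eq_mul]
      field_simp
      ring
    · simp [hMp, hvw]
  · convert PosSemidef.diagonal (d := fun v => 1 / q v - 1)
      (fun v => sub_nonneg.2 ((one_le_div (hq v).1).2 (hq v).2)) using 1
    ext v w
    by_cases hvw : v = w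
    · subst hvw
      simp [hMq]
    · simp [hMq, hvw]
end

section
/- Let K be a 2×2 real symmetric positive definite matrix with entries K_{11}, K_{12}, K_{22}, and let μ be the centered bivariate Gaussian measure on ℝ² with covariance matrix K. Define θ = arccos( K_{12} / √(K_{11} K_{22}) ). Then ∫ relu(z_1) · relu(z_2) dμ(z) = (1/(2π)) √(K_{11} K_{22}) ( sin θ + (π − θ) cos θ ), where relu(x) = max(x, 0). (Closed form of the second raw moment C for the ReLU activation, Section C; the order-1 arc-cosine kernel.) -/
open Matrix MeasureTheory Real

/-- The centered bivariate Gaussian measure with covariance matrix `K`,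
defined by its density `(2π √(det K))⁻¹ exp(−zᵀK⁻¹z/2)` with respect to
the Lebesgue measure on `ℝ²`. -/
noncomputable def gaussianOfCov (K : Matrix (Fin 2) (Fin 2) ℝ) :
    Measure (Fin 2 → ℝ) :=
  volume.withDensity fun z =>
    ENNReal.ofReal ((2 * π * Real.sqrt K.det)⁻¹ *
      Real.exp (-(z ⬝ᵥ (K⁻¹ *ᵥ z)) / 2))

theorem integral_Ioi_pow_three_mul_exp_neg_sq_div_two :
    ∫ r in Set.Ioi (0 : ℝ), r ^ 3 * Real.exp (-r ^ 2 / 2) = 2 := by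
  have h := integral_rpow_mul_exp_neg_mul_rpow (p := 2) (q := 3) (b := 1 / 2)
    (by norm_num) (by norm_num) (by norm_num)
  have hval : (1 / 2 : ℝ) ^ (-((3 : ℝ) + 1) / 2) * (1 / 2) * Real.Gamma ((3 + 1) / 2) = 2 := by
    rw [show (-((3 : ℝ) + 1) / 2) = -(2 : ℕ) by norm_num,
      show ((3 : ℝ) + 1) / 2 = 2 by norm_num, Real.Gamma_two, Real.rpow_neg (by norm_num),
      Real.rpow_natCast]
    norm_num
  rw [hval] at h
  refine Eq.trans (integral_congr_ae (Filter.Eventually.of_forall fun r => ?_)) h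
  have h3 : r ^ (3 : ℝ) = r ^ 3 := by exact_mod_cast Real.rpow_natCast r 3
  have h2 : r ^ (2 : ℝ) = r ^ 2 := by exact_mod_cast Real.rpow_natCast r 2
  simp only [h3, h2]
  ring_nf

theorem hasDerivAt_primitive_cos_mul_cos_sub (θ t : ℝ) :
    HasDerivAt (fun t => t * Real.cos θ / 2 + Real.sin (2 * t - θ) / 4)
      (Real.cos t * Real.cos (t - θ)) t := by
  have h1 : HasDerivAt (fun t : ℝ => 2 * t - θ) 2 t := by
    simpa using ((hasDerivAt_id t).const_mul 2).sub_const θ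
  have h2 := ((((hasDerivAt_id t).mul_const (Real.cos θ)).div_const 2).add (h1.sin.div_const 4))
  refine HasDerivAt.congr_deriv h2 ?_
  have e1 : Real.cos θ = Real.cos (t - (t - θ)) := by ring_nf
  have e2 : Real.cos (2 * t - θ) = Real.cos (t + (t - θ)) := by ring_nf
  rw [e1, e2, Real.cos_sub t (t - θ), Real.cos_add t (t - θ)]
  ring

theorem integral_Ioo_relu_cos_mul_relu_cos_sub {θ : ℝ} (h0 : 0 ≤ θ) (hπ : θ ≤ π) :
    ∫ t in Set.Ioo (-π) π, max (Real.cos t) 0 * max (Real.cos (t - θ)) 0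
      = (Real.sin θ + (π - θ) * Real.cos θ) / 2 := by
  have hpi := Real.pi_pos
  have hle : θ - π / 2 ≤ π / 2 := by linarith
  have hsub : Set.Ioc (θ - π / 2) (π / 2) ⊆ Set.Ioo (-π) π := fun t ht =>
    ⟨by linarith [ht.1], by linarith [ht.2]⟩
  rw [setIntegral_eq_of_subset_of_forall_sdiff_eq_zero measurableSet_Ioo hsub]
  · have hcongr : ∫ t in Set.Ioc (θ - π / 2) (π / 2),
        max (Real.cos t) 0 * max (Real.cos (t - θ)) 0
        = ∫ t in Set.Ioc (θ - π / 2) (π / 2), Real.cos t * Real.cos (t - θ) := by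
      refine setIntegral_congr_fun measurableSet_Ioc fun t ht => ?_
      have hc1 : 0 ≤ Real.cos t :=
        Real.cos_nonneg_of_mem_Icc ⟨by linarith [ht.1], by linarith [ht.2]⟩
      have hc2 : 0 ≤ Real.cos (t - θ) :=
        Real.cos_nonneg_of_mem_Icc ⟨by linarith [ht.1], by linarith [ht.2]⟩
      simp only [max_eq_left hc1, max_eq_left hc2]
    rw [hcongr, ← intervalIntegral.integral_of_le hle,
      intervalIntegral.integral_eq_sub_of_hasDerivAt
        (fun t _ => hasDerivAt_primitive_cos_mul_cos_sub θ t)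
        (Continuous.intervalIntegrable (by fun_prop) _ _),
      show 2 * (π / 2) - θ = π - θ by ring,
      show 2 * (θ - π / 2) - θ = -(π - θ) by ring, Real.sin_neg, Real.sin_pi_sub]
    ring
  · rintro t ⟨⟨ht1, ht2⟩, ht⟩
    rw [Set.mem_Ioc, not_and_or, not_lt, not_le] at ht
    have hneg : Real.cos t ≤ 0 ∨ Real.cos (t - θ) ≤ 0 := by
      rcases ht with ht | ht
      · by_cases h : t ≤ -(π / 2)
        · left
          rw [← Real.cos_neg]
          exact Real.cos_nonpos_of_pi_div_two_le_of_le (by linarith) (by linarith)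
        · right
          rw [← Real.cos_neg]
          exact Real.cos_nonpos_of_pi_div_two_le_of_le (by linarith) (by linarith)
      · left
        exact Real.cos_nonpos_of_pi_div_two_le_of_le (by linarith) (by linarith)
    rcases hneg with h | h <;> simp [max_eq_right h]

theorem integral_relu_mul_relu_cos_sin_mul_exp {θ : ℝ} (h0 : 0 ≤ θ) (hπ : θ ≤ π) :
    ∫ p : ℝ × ℝ, max p.1 0 * max (Real.cos θ * p.1 + Real.sin θ * p.2) 0 *
        Real.exp (-(p.1 ^ 2 + p.2 ^ 2) / 2)
      = Real.sin θ + (π - θ) * Real.cos θ := by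
  rw [← integral_comp_polarCoord_symm, polarCoord_target]
  have hcongr : ∀ p ∈ Set.Ioi (0 : ℝ) ×ˢ Set.Ioo (-π) π,
      p.1 • (max (polarCoord.symm p).1 0 *
        max (Real.cos θ * (polarCoord.symm p).1 + Real.sin θ * (polarCoord.symm p).2) 0 *
        Real.exp (-((polarCoord.symm p).1 ^ 2 + (polarCoord.symm p).2 ^ 2) / 2))
      = (p.1 ^ 3 * Real.exp (-p.1 ^ 2 / 2)) *
        (max (Real.cos p.2) 0 * max (Real.cos (p.2 - θ)) 0) := by
    rintro ⟨r, t⟩ ⟨hr, -⟩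
    have hr : 0 ≤ r := le_of_lt hr
    have hscale : ∀ x : ℝ, max (r * x) 0 = r * max x 0 := fun x => by
      rw [mul_max_of_nonneg _ _ hr, mul_zero]
    have e1 : Real.cos θ * (r * Real.cos t) + Real.sin θ * (r * Real.sin t)
        = r * Real.cos (t - θ) := by
      rw [Real.cos_sub]; ring
    have e2 : (r * Real.cos t) ^ 2 + (r * Real.sin t) ^ 2 = r ^ 2 := by
      rw [mul_pow, mul_pow, ← mul_add, Real.cos_sq_add_sin_sq, mul_one]
    simp only [polarCoord_symm_apply, e1, e2, hscale, smul_eq_mul]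
    ring
  rw [setIntegral_congr_fun (measurableSet_Ioi.prod measurableSet_Ioo) hcongr,
    Measure.volume_eq_prod,
    setIntegral_prod_mul (fun r : ℝ => r ^ 3 * Real.exp (-r ^ 2 / 2))
      (fun t => max (Real.cos t) 0 * max (Real.cos (t - θ)) 0),
    integral_Ioi_pow_three_mul_exp_neg_sq_div_two, integral_Ioo_relu_cos_mul_relu_cos_sub h0 hπ]
  ring

theorem dotProduct_mulVec_inv_mul_transpose {M : Matrix (Fin 2) (Fin 2) ℝ} (hM : M.det ≠ 0)
    (x : Fin 2 → ℝ) : (M *ᵥ x) ⬝ᵥ ((M * Mᵀ)⁻¹ *ᵥ (M *ᵥ x)) = x ⬝ᵥ x := by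
  have hu : IsUnit M.det := hM.isUnit
  have hut : IsUnit Mᵀ.det := by rwa [det_transpose]
  have h : Mᵀ * ((Mᵀ)⁻¹ * M⁻¹ * M) = 1 := by
    rw [Matrix.mul_assoc, nonsing_inv_mul _ hu, Matrix.mul_one, mul_nonsing_inv _ hut]
  rw [Matrix.mul_inv_rev, mulVec_mulVec, dotProduct_mulVec, vecMul_mulVec, h, vecMul_one]

theorem integral_gaussianOfCov_mul_transpose {M : Matrix (Fin 2) (Fin 2) ℝ} (hM : M.det ≠ 0)
    {f : (Fin 2 → ℝ) → ℝ} (hf : Continuous f) :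
    ∫ z, f z ∂(gaussianOfCov (M * Mᵀ))
      = (2 * π)⁻¹ * ∫ x : Fin 2 → ℝ, f (M *ᵥ x) * Real.exp (-(x ⬝ᵥ x) / 2) := by
  have hdens : Continuous fun z : Fin 2 → ℝ => (2 * π * Real.sqrt (M * Mᵀ).det)⁻¹ *
      Real.exp (-(z ⬝ᵥ ((M * Mᵀ)⁻¹ *ᵥ z)) / 2) := by
    have hq : Continuous fun z : Fin 2 → ℝ => z ⬝ᵥ ((M * Mᵀ)⁻¹ *ᵥ z) :=
      continuous_id.dotProduct (continuous_const.matrix_mulVec continuous_id)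
    fun_prop
  have hsqrt : Real.sqrt (M * Mᵀ).det = |M.det| := by
    rw [det_mul, det_transpose, Real.sqrt_mul_self_eq_abs]
  have habs : |M.det| ≠ 0 := abs_ne_zero.mpr hM
  set g : (Fin 2 → ℝ) → ℝ := fun z => (2 * π * Real.sqrt (M * Mᵀ).det)⁻¹ *
      Real.exp (-(z ⬝ᵥ ((M * Mᵀ)⁻¹ *ᵥ z)) / 2) * f z with hg
  have hgc : Continuous g := hdens.mul hf
  have hleft : ∫ z, f z ∂(gaussianOfCov (M * Mᵀ)) = ∫ z, g z := by
    rw [gaussianOfCov, integral_withDensity_eq_integral_toReal_smul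
      hdens.measurable.ennreal_ofReal (by simp)]
    refine integral_congr_ae (Filter.Eventually.of_forall fun z => ?_)
    simp only [hg, smul_eq_mul]
    rw [ENNReal.toReal_ofReal (by positivity)]
  have hmap := integral_map (μ := (volume : Measure (Fin 2 → ℝ))) (φ := Matrix.toLin' M)
    (LinearMap.continuous_of_finiteDimensional _).aemeasurable
    (f := g) hgc.aestronglyMeasurable
  rw [Real.map_matrix_volume_pi_eq_smul_volume_pi hM, integral_smul_measure,
    ENNReal.toReal_ofReal (abs_nonneg _), abs_inv, smul_eq_mul,
    inv_mul_eq_iff_eq_mul₀ habs] at hmap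
  rw [hleft, hmap, ← integral_const_mul, ← integral_const_mul]
  refine integral_congr_ae (Filter.Eventually.of_forall fun x => ?_)
  simp only [hg, toLin'_apply, dotProduct_mulVec_inv_mul_transpose hM, hsqrt]
  have := Real.pi_ne_zero
  field_simp

theorem integral_relu_mul_relu_gaussianOfCov {a b θ : ℝ} (ha : 0 < a) (hb : 0 < b)
    (h0 : 0 < θ) (hπ : θ < π) :
    ∫ z, max (z 0) 0 * max (z 1) 0 ∂(gaussianOfCov
        (!![a, 0; b * Real.cos θ, b * Real.sin θ] * !![a, 0; b * Real.cos θ, b * Real.sin θ]ᵀ))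
      = (2 * π)⁻¹ * (a * b) * (Real.sin θ + (π - θ) * Real.cos θ) := by
  have hs := Real.sin_pos_of_pos_of_lt_pi h0 hπ
  have hdet : (!![a, 0; b * Real.cos θ, b * Real.sin θ] : Matrix (Fin 2) (Fin 2) ℝ).det ≠ 0 := by
    rw [det_fin_two_of]
    have : 0 < a * (b * Real.sin θ) := by positivity
    linarith
  rw [integral_gaussianOfCov_mul_transpose hdet
      (f := fun z => max (z 0) 0 * max (z 1) 0) (by fun_prop),
    ← integral_relu_mul_relu_cos_sin_mul_exp h0.le hπ.le,
    ← (volume_preserving_finTwoArrow ℝ).integral_comp', mul_assoc, ← integral_const_mul (a * b)]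
  congr 1
  refine integral_congr_ae (Filter.Eventually.of_forall fun x => ?_)
  have hscale : ∀ {r : ℝ}, 0 < r → ∀ y : ℝ, max (r * y) 0 = r * max y 0 := fun hr y => by
    rw [mul_max_of_nonneg _ _ hr.le, mul_zero]
  have e1 : b * Real.cos θ * x 0 + b * Real.sin θ * x 1
      = b * (Real.cos θ * x 0 + Real.sin θ * x 1) := by ring
  simp only [mulVec, dotProduct, Fin.sum_univ_two, MeasurableEquiv.finTwoArrow_apply,
    of_apply, cons_val_zero, cons_val_one, zero_mul, add_zero, e1, hscale ha, hscale hb]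
  ring_nf

/-- Closed form of the second raw moment `C` for the ReLU activation
(Section C; the order-1 arc-cosine kernel):
`E[relu(z_1) relu(z_2)] = (1/(2π)) √(K₁₁K₂₂) (sin θ + (π − θ) cos θ)`
for `z ∼ N(0, K)` and `θ = arccos(K₁₂/√(K₁₁K₂₂))`. -/
theorem relu_second_raw_moment
    (K : Matrix (Fin 2) (Fin 2) ℝ) (hK : K.PosDef)
    (θ : ℝ) (hθ : θ = Real.arccos (K 0 1 / Real.sqrt (K 0 0 * K 1 1))) :
    (∫ z, max (z 0) 0 * max (z 1) 0 ∂(gaussianOfCov K))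
      = (2 * π)⁻¹ * Real.sqrt (K 0 0 * K 1 1)
          * (Real.sin θ + (π - θ) * Real.cos θ) := by
  have ha : 0 < K 0 0 := hK.diag_pos
  have hb : 0 < K 1 1 := hK.diag_pos
  have hsymm : K 1 0 = K 0 1 := by simpa using hK.isHermitian.apply 0 1
  have hdet : K 0 1 ^ 2 < K 0 0 * K 1 1 := by
    have h := hK.det_pos
    rw [det_fin_two, hsymm] at h
    linarith
  have hab : 0 < Real.sqrt (K 0 0 * K 1 1) := Real.sqrt_pos.mpr (mul_pos ha hb)
  obtain ⟨hlo, hhi⟩ := abs_lt.mp (Real.lt_sqrt_of_sq_lt ((sq_abs (K 0 1)).trans_lt hdet))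
  have hc1 : -1 < K 0 1 / Real.sqrt (K 0 0 * K 1 1) := by
    rw [lt_div_iff₀ hab]; linarith
  have hc2 : K 0 1 / Real.sqrt (K 0 0 * K 1 1) < 1 := by
    rw [div_lt_one hab]; exact hhi
  have hcos : Real.sqrt (K 0 0 * K 1 1) * Real.cos θ = K 0 1 := by
    rw [hθ, Real.cos_arccos hc1.le hc2.le, mul_div_cancel₀ _ hab.ne']
  have h0 : 0 < θ := hθ ▸ Real.arccos_pos.mpr hc2
  have hπ : θ < π := by
    rw [hθ]
    exact lt_of_le_of_ne (Real.arccos_le_pi _) fun h => hc1.not_ge (Real.arccos_eq_pi.mp h)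
  rw [Real.sqrt_mul ha.le] at hcos ⊢
  rw [← integral_relu_mul_relu_gaussianOfCov (Real.sqrt_pos.mpr ha) (Real.sqrt_pos.mpr hb) h0 hπ]
  have hA := Real.mul_self_sqrt ha.le
  have hB := Real.mul_self_sqrt hb.le
  congr 2
  ext i j
  fin_cases i <;> fin_cases j <;> simp [Matrix.mul_apply, Fin.sum_univ_two]
  · exact hA.symm
  · linear_combination -hcos
  · linear_combination hsymm - hcos
  · linear_combination -hB - Real.sqrt (K 1 1) ^ 2 * Real.sin_sq_add_cos_sq θ
end

section
/- Let K be a 2×2 real symmetric positive definite matrix with entries K_{11}, K_{12}, K_{22}, and let μ be the centered bivariate Gaussian measure on ℝ² with covariance matrix K. Define θ = arccos( K_{12} / √(K_{11} K_{22}) ). Then μ( { z ∈ ℝ² : z_1 > 0 and z_2 > 0 } ) = (π − θ)/(2π); equivalently, ∫ 1{z_1 > 0} · 1{z_2 > 0} dμ(z) = (1/(2π))(π − θ). (Closed form of the second raw moment Ċ for the ReLU activation, Section C; the order-0 arc-cosine kernel / Gaussian orthant probability.) -/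
open Matrix MeasureTheory Real

/-- A nonsingular linear map pushes the standard Gaussian forward to the Gaussian of
covariance `M * Mᵀ`. -/
lemma gaussianOfCov_mul_transpose_apply (M : Matrix (Fin 2) (Fin 2) ℝ) (hM : M.det ≠ 0)
    {S : Set (Fin 2 → ℝ)} (hS : MeasurableSet S) :
    gaussianOfCov (M * Mᵀ) S = gaussianOfCov 1 ((M *ᵥ ·) ⁻¹' S) := by
  have hcont : Continuous (fun w : Fin 2 → ℝ => M *ᵥ w) := by fun_prop
  have hvol : (volume : Measure (Fin 2 → ℝ)) =
      ENNReal.ofReal |M.det| • Measure.map (fun w => M *ᵥ w) volume := by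
    have h := Real.map_matrix_volume_pi_eq_smul_volume_pi hM
    have hfun : ⇑(toLin' M) = fun w => M *ᵥ w := by
      ext w; simp
    rw [hfun] at h
    rw [h, smul_smul, ← ENNReal.ofReal_mul (abs_nonneg _), ← abs_mul, mul_inv_cancel₀ hM]
    simp
  have hmeas : Measurable fun z : Fin 2 → ℝ =>
      ENNReal.ofReal ((2 * π * √(M * Mᵀ).det)⁻¹ *
        Real.exp (-(z ⬝ᵥ ((M * Mᵀ)⁻¹ *ᵥ z)) / 2)) := by
    apply Measurable.ennreal_ofReal
    exact Continuous.measurable (by fun_prop)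
  have hMu : IsUnit M.det := isUnit_iff_ne_zero.mpr hM
  have hMinv : M⁻¹ * M = 1 := nonsing_inv_mul _ hMu
  have hquad (w : Fin 2 → ℝ) : (M *ᵥ w) ⬝ᵥ ((M * Mᵀ)⁻¹ *ᵥ (M *ᵥ w)) = w ⬝ᵥ w := by
    rw [mulVec_mulVec, Matrix.mul_inv_rev, Matrix.mul_assoc, hMinv, Matrix.mul_one,
      ← transpose_nonsing_inv, mulVec_transpose, dotProduct_comm, ← dotProduct_mulVec,
      mulVec_mulVec, hMinv, one_mulVec]
  have hdet : √(M * Mᵀ).det = |M.det| := by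
    rw [det_mul, det_transpose, ← sq, sqrt_sq_eq_abs]
  unfold gaussianOfCov
  rw [withDensity_apply _ hS, withDensity_apply _ (hcont.measurable hS)]
  conv_lhs => rw [hvol]
  rw [Measure.restrict_smul, lintegral_smul_measure,
    setLIntegral_map hS hmeas hcont.measurable, smul_eq_mul,
    ← lintegral_const_mul' _ _ ENNReal.ofReal_ne_top]
  refine lintegral_congr fun w => ?_
  have hpos : 0 < |M.det| := abs_pos.mpr hM
  rw [← ENNReal.ofReal_mul hpos.le, hquad, hdet]
  congr 1
  simp
  field_simp

/-- Total mass of the Rayleigh density. -/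
lemma lintegral_Ioi_mul_exp_neg_sq_div_two :
    ∫⁻ r in Set.Ioi (0 : ℝ), ENNReal.ofReal (r * exp (-(r ^ 2) / 2)) = 1 := by
  have hfun : (fun r : ℝ => r * exp (-(r ^ 2) / 2)) = fun r => r * exp (-(1 / 2) * r ^ 2) := by
    ext r; ring_nf
  rw [← ofReal_integral_eq_lintegral_ofReal]
  · have h := integral_rpow_mul_exp_neg_mul_rpow (p := 2) (q := 1) (b := 1 / 2)
      (by norm_num) (by norm_num) (by norm_num)
    rw [hfun]
    norm_num [rpow_neg_one] at h ⊢
    exact h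
  · rw [hfun]
    exact (integrable_mul_exp_neg_mul_sq (by norm_num)).integrableOn
  · filter_upwards [ae_restrict_mem measurableSet_Ioi] with r hr
    exact mul_nonneg (le_of_lt hr) (exp_pos _).le

lemma cos_pos_and_cos_sub_pos_iff {θ t : ℝ} (h0 : 0 < θ) (hπ : θ < π)
    (ht : t ∈ Set.Ioo (-π) π) :
    (0 < cos t ∧ 0 < cos (t - θ)) ↔ t ∈ Set.Ioo (θ - π / 2) (π / 2) := by
  obtain ⟨ht1, ht2⟩ := ht
  constructor
  · rintro ⟨h1, h2⟩
    have hlt : t < π / 2 := by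
      by_contra! h
      exact absurd (cos_nonpos_of_pi_div_two_le_of_le h (by linarith)) (not_le.mpr h1)
    have hgt : -(π / 2) < t := by
      by_contra! h
      rw [← cos_neg] at h1
      exact absurd (cos_nonpos_of_pi_div_two_le_of_le (by linarith) (by linarith))
        (not_le.mpr h1)
    refine ⟨?_, hlt⟩
    by_contra! h
    rw [← cos_neg] at h2
    exact absurd (cos_nonpos_of_pi_div_two_le_of_le (by linarith) (by linarith))
      (not_le.mpr h2)
  · rintro ⟨h1, h2⟩
    exact ⟨cos_pos_of_mem_Ioo ⟨by linarith, h2⟩,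
      cos_pos_of_mem_Ioo ⟨by linarith, by linarith⟩⟩

/-- The standard Gaussian measure of a planar sector, here the intersection of two half-planes
whose inner normals form the angle `θ`. -/
lemma gaussianOfCov_one_sector {θ : ℝ} (h0 : 0 < θ) (hπ : θ < π) :
    gaussianOfCov 1 {w | 0 < w 0 ∧ 0 < cos θ * w 0 + sin θ * w 1} =
      ENNReal.ofReal ((π - θ) / (2 * π)) := by
  have hS : MeasurableSet {w : Fin 2 → ℝ | 0 < w 0 ∧ 0 < cos θ * w 0 + sin θ * w 1} := by
    measurability
  unfold gaussianOfCov
  rw [withDensity_apply _ hS, ← lintegral_indicator hS,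
    ← (volume_preserving_finTwoArrow ℝ).symm.lintegral_comp_emb
      (MeasurableEquiv.measurableEmbedding _),
    ← lintegral_comp_polarCoord_symm]
  have hpolar : ∀ p ∈ polarCoord.target, ENNReal.ofReal p.1 •
      Set.indicator {w : Fin 2 → ℝ | 0 < w 0 ∧ 0 < cos θ * w 0 + sin θ * w 1}
        (fun z => ENNReal.ofReal ((2 * π * √(1 : Matrix (Fin 2) (Fin 2) ℝ).det)⁻¹ *
          exp (-(z ⬝ᵥ ((1 : Matrix (Fin 2) (Fin 2) ℝ)⁻¹ *ᵥ z)) / 2)))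
        (MeasurableEquiv.finTwoArrow.symm (polarCoord.symm p)) =
      ENNReal.ofReal (p.1 * exp (-(p.1 ^ 2) / 2)) *
        Set.indicator (Set.Ioo (θ - π / 2) (π / 2))
          (fun _ => ENNReal.ofReal (2 * π)⁻¹) p.2 := by
    rintro ⟨r, t⟩ ⟨hr, ht⟩
    replace hr : 0 < r := hr
    have hmem : (MeasurableEquiv.finTwoArrow.symm (polarCoord.symm (r, t)) ∈
        {w : Fin 2 → ℝ | 0 < w 0 ∧ 0 < cos θ * w 0 + sin θ * w 1}) ↔
        t ∈ Set.Ioo (θ - π / 2) (π / 2) := by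
      rw [← cos_pos_and_cos_sub_pos_iff h0 hπ ht]
      have hrot : cos θ * (r * cos t) + sin θ * (r * sin t) = r * cos (t - θ) := by
        rw [cos_sub]; ring
      change (0 < r * cos t ∧ 0 < cos θ * (r * cos t) + sin θ * (r * sin t)) ↔ _
      rw [hrot, mul_pos_iff_of_pos_left hr, mul_pos_iff_of_pos_left hr]
    by_cases h : t ∈ Set.Ioo (θ - π / 2) (π / 2)
    · rw [Set.indicator_of_mem (hmem.mpr h), Set.indicator_of_mem h, smul_eq_mul,
        ← ENNReal.ofReal_mul hr.le, ← ENNReal.ofReal_mul (by positivity)]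
      have hsq : MeasurableEquiv.finTwoArrow.symm (polarCoord.symm (r, t)) ⬝ᵥ
          MeasurableEquiv.finTwoArrow.symm (polarCoord.symm (r, t)) = r ^ 2 := by
        rw [dotProduct, Fin.sum_univ_two]
        change r * cos t * (r * cos t) + r * sin t * (r * sin t) = r ^ 2
        linear_combination r ^ 2 * sin_sq_add_cos_sq t
      rw [inv_one, one_mulVec, hsq, det_one, sqrt_one]
      congr 1
      ring
    · rw [Set.indicator_of_notMem (mt hmem.mp h), Set.indicator_of_notMem h]
      simp
  have htarget : MeasurableSet polarCoord.target := polarCoord.open_target.measurableSet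
  rw [setLIntegral_congr_fun htarget hpolar, polarCoord_target, Measure.volume_eq_prod,
    ← Measure.prod_restrict, lintegral_prod_mul
      (f := fun r : ℝ => ENNReal.ofReal (r * exp (-(r ^ 2) / 2))) (by fun_prop)
      ((measurable_const.indicator measurableSet_Ioo).aemeasurable),
    lintegral_Ioi_mul_exp_neg_sq_div_two, one_mul, lintegral_indicator_const measurableSet_Ioo,
    Measure.restrict_apply measurableSet_Ioo, Set.inter_eq_left.mpr
      (Set.Ioo_subset_Ioo (by linarith) (by linarith)), volume_Ioo,
    ← ENNReal.ofReal_mul (by positivity)]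
  congr 1
  field_simp
  ring

/-- Closed form of the second raw moment `Ċ` for the ReLU activation
(Section C; the order-0 arc-cosine kernel / Gaussian orthant probability):
`P(z_1 > 0, z_2 > 0) = (π − θ)/(2π)` for `z ∼ N(0, K)` and
`θ = arccos(K₁₂/√(K₁₁K₂₂))`. -/
theorem relu_derivative_second_raw_moment
    (K : Matrix (Fin 2) (Fin 2) ℝ) (hK : K.PosDef)
    (θ : ℝ) (hθ : θ = Real.arccos (K 0 1 / Real.sqrt (K 0 0 * K 1 1))) :
    gaussianOfCov K {z | 0 < z 0 ∧ 0 < z 1}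
      = ENNReal.ofReal ((π - θ) / (2 * π)) := by
  have hS : MeasurableSet {z : Fin 2 → ℝ | 0 < z 0 ∧ 0 < z 1} := by
    measurability
  have ha : 0 < K 0 0 := hK.diag_pos
  have hb : 0 < K 1 1 := hK.diag_pos
  have hsymm : K 1 0 = K 0 1 := by simpa using hK.isHermitian.apply 0 1
  have hdet : 0 < K 0 0 * K 1 1 - K 0 1 ^ 2 := by
    have h := hK.det_pos
    rw [det_fin_two, hsymm] at h
    linarith
  have hs : 0 < √(K 0 0 * K 1 1) := sqrt_pos.mpr (mul_pos ha hb)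
  have habs : |K 0 1| < √(K 0 0 * K 1 1) := by
    rw [← sqrt_sq_eq_abs]
    exact sqrt_lt_sqrt (sq_nonneg _) (by linarith)
  obtain ⟨hlo, hhi⟩ := abs_lt.mp habs
  have hc1 : -1 < K 0 1 / √(K 0 0 * K 1 1) := by rw [lt_div_iff₀ hs]; linarith
  have hc2 : K 0 1 / √(K 0 0 * K 1 1) < 1 := by rw [div_lt_iff₀ hs]; linarith
  have hcos : cos θ = K 0 1 / √(K 0 0 * K 1 1) := by rw [hθ, cos_arccos hc1.le hc2.le]
  have h0 : 0 < θ := by rw [hθ]; exact arccos_pos.mpr hc2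
  have hπ : θ < π := by
    refine lt_of_le_of_ne (hθ ▸ arccos_le_pi _) fun h => ?_
    rw [h, cos_pi] at hcos
    linarith
  have hsin : 0 < sin θ := sin_pos_of_pos_of_lt_pi h0 hπ
  have hra : 0 < √(K 0 0) := sqrt_pos.mpr ha
  have hrb : 0 < √(K 1 1) := sqrt_pos.mpr hb
  have hsqa : √(K 0 0) ^ 2 = K 0 0 := sq_sqrt ha.le
  have hsqb : √(K 1 1) ^ 2 = K 1 1 := sq_sqrt hb.le
  have hK01 : √(K 0 0) * (√(K 1 1) * cos θ) = K 0 1 := by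
    rw [hcos, sqrt_mul ha.le]
    field_simp
  set M : Matrix (Fin 2) (Fin 2) ℝ :=
    !![√(K 0 0), 0; √(K 1 1) * cos θ, √(K 1 1) * sin θ] with hM
  have hMdet : M.det ≠ 0 := by
    rw [hM, det_fin_two_of]
    have : 0 < √(K 0 0) * (√(K 1 1) * sin θ) := by positivity
    linarith
  have hfactor : K = M * Mᵀ := by
    ext i j
    fin_cases i <;> fin_cases j <;> simp [hM, Matrix.mul_apply, Fin.sum_univ_two]
    · linarith
    · linarith
    · linarith
    · linear_combination -hsqb - √(K 1 1) ^ 2 * sin_sq_add_cos_sq θ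
  rw [hfactor, gaussianOfCov_mul_transpose_apply M hMdet hS, ← gaussianOfCov_one_sector h0 hπ]
  congr 1
  ext w
  have h1 : (M *ᵥ w) 0 = √(K 0 0) * w 0 := by
    simp [hM, mulVec, dotProduct, Fin.sum_univ_two]
  have h2 : (M *ᵥ w) 1 = √(K 1 1) * (cos θ * w 0 + sin θ * w 1) := by
    simp [hM, mulVec, dotProduct, Fin.sum_univ_two]
    ring
  simp only [Set.mem_preimage, Set.mem_ofPred_eq]
  rw [h1, h2, mul_pos_iff_of_pos_left hra, mul_pos_iff_of_pos_left hrb]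
end

section
/- Let K₁ = [[2.58, 0.83], [0.83, 0.62]] and K₂ = [[1.52, 0.76], [0.76, 0.61]]. Then K₁ and K₂ are symmetric positive definite, K₁ − K₂ is positive semidefinite, and yet the matrix C₁ − C₂ is NOT positive semidefinite, where for i = 1, 2 the 2×2 matrix Cᵢ is defined entrywise by (Cᵢ)_{xx'} = ∫ relu(z_x) relu(z_{x'}) dμᵢ(z) with μᵢ the centered bivariate Gaussian measure of covariance Kᵢ and relu(x) = max(x,0). Hence the Loewner order K₁ ⪰ K₂ on pre-activation covariances does not imply the Loewner order C₁ ⪰ C₂ on post-activation second raw moments for the ReLU activation. (Counterexample of Section D.) -/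
open Matrix MeasureTheory Real

/-- The second raw moment matrix of the ReLU post-activation:
`C_{xx'} = E_{z ∼ N(0,K)}[ relu(z_x) relu(z_{x'}) ]`. -/
noncomputable def reluMoment (K : Matrix (Fin 2) (Fin 2) ℝ) :
    Matrix (Fin 2) (Fin 2) ℝ :=
  Matrix.of fun x x' => ∫ z, max (z x) 0 * max (z x') 0 ∂(gaussianOfCov K)

open Set Filter Topology

theorem tendsto_div_sq_add_sq_atTop (s : ℝ) :
    Tendsto (fun u : ℝ => u / (u ^ 2 + s ^ 2)) atTop (𝓝 0) := by
  refine squeeze_zero' ?_ ?_ tendsto_inv_atTop_zero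
  · filter_upwards [eventually_gt_atTop 0] with u hu
    positivity
  · filter_upwards [eventually_gt_atTop 0] with u hu
    rw [div_le_iff₀ (by positivity), inv_mul_eq_div, le_div_iff₀ hu]
    nlinarith [sq_nonneg s]

theorem tendsto_inv_sq_add_sq_atTop (s : ℝ) :
    Tendsto (fun u : ℝ => 1 / (u ^ 2 + s ^ 2)) atTop (𝓝 0) := by
  refine squeeze_zero' ?_ ?_ (tendsto_div_sq_add_sq_atTop s)
  · filter_upwards with u
    positivity
  · filter_upwards [eventually_ge_atTop 1] with u hu
    gcongr

theorem tendsto_linear_atTop {C : ℝ} (hC : 0 < C) (B : ℝ) :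
    Tendsto (fun t : ℝ => C * t + B) atTop atTop :=
  tendsto_atTop_add_const_right _ _ (tendsto_id.const_mul_atTop hC)

theorem quadratic_pos {A B C s : ℝ} (hC : 0 < C) (hs : 0 < s)
    (h : A * C - B ^ 2 = s ^ 2) (t : ℝ) : 0 < A + 2 * B * t + C * t ^ 2 := by
  have : C * (A + 2 * B * t + C * t ^ 2) = (C * t + B) ^ 2 + s ^ 2 := by linear_combination h
  have h2 : 0 < C * (A + 2 * B * t + C * t ^ 2) := by rw [this]; positivity
  exact pos_of_mul_pos_right h2 hC.le

theorem hasDerivAt_arctan_linear_div {C s : ℝ} (hs : 0 < s) (B t : ℝ) :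
    HasDerivAt (fun t : ℝ => arctan ((C * t + B) / s)) (C * s / ((C * t + B) ^ 2 + s ^ 2)) t := by
  have h1 : HasDerivAt (fun t : ℝ => (C * t + B) / s) (C / s) t := by
    simpa using (((hasDerivAt_id t).const_mul C).add_const B).div_const s
  convert h1.arctan using 1
  field_simp
  ring

theorem lintegral_Ioi_of_hasDerivAt_of_nonneg {g g' : ℝ → ℝ} {a l : ℝ}
    (hderiv : ∀ x ∈ Ici a, HasDerivAt g (g' x) x) (g'pos : ∀ x ∈ Ioi a, 0 ≤ g' x)
    (hg : Tendsto g atTop (𝓝 l)) :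
    0 ≤ l - g a ∧ ∫⁻ x in Ioi a, ENNReal.ofReal (g' x) = ENNReal.ofReal (l - g a) := by
  rw [← integral_Ioi_of_hasDerivAt_of_nonneg' hderiv g'pos hg]
  refine ⟨setIntegral_nonneg measurableSet_Ioi g'pos, ?_⟩
  rw [ofReal_integral_eq_lintegral_ofReal (integrableOn_Ioi_deriv_of_nonneg' hderiv g'pos hg)]
  exact (ae_restrict_iff' measurableSet_Ioi).2 (Eventually.of_forall g'pos)

theorem lintegral_Ioi_inv_quadratic_sq {A B C s : ℝ} (hC : 0 < C) (hs : 0 < s)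
    (h : A * C - B ^ 2 = s ^ 2) :
    0 ≤ 1 / s ^ 2 * (C / s * (π / 2) -
        (C * (B / (B ^ 2 + s ^ 2)) + C / s * arctan (B / s))) ∧
    ∫⁻ t in Ioi (0 : ℝ), ENNReal.ofReal (2 / (A + 2 * B * t + C * t ^ 2) ^ 2) =
      ENNReal.ofReal (1 / s ^ 2 * (C / s * (π / 2) -
        (C * (B / (B ^ 2 + s ^ 2)) + C / s * arctan (B / s)))) := by
  have hlin := tendsto_linear_atTop hC B
  have key := lintegral_Ioi_of_hasDerivAt_of_nonneg (a := 0)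
    (g := fun t => 1 / s ^ 2 * (C * ((C * t + B) / ((C * t + B) ^ 2 + s ^ 2)) +
      C / s * arctan ((C * t + B) / s)))
    (g' := fun t => 2 / (A + 2 * B * t + C * t ^ 2) ^ 2)
    (l := 1 / s ^ 2 * (C * 0 + C / s * (π / 2))) ?_ ?_ ?_
  · convert key using 2
    all_goals simp only [mul_zero, zero_add]
    on_goal 2 => congr 1
    all_goals ring
  · intro t _
    have hp := quadratic_pos hC hs h t
    have hl : HasDerivAt (fun t : ℝ => C * t + B) C t := by
      simpa using ((hasDerivAt_id t).const_mul C).add_const B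
    have hq : (C * t + B) ^ 2 + s ^ 2 = C * (A + 2 * B * t + C * t ^ 2) := by
      linear_combination -h
    have hd : HasDerivAt (fun t : ℝ => (C * t + B) ^ 2 + s ^ 2) (2 * (C * t + B) * C) t := by
      simpa using (hl.pow 2).add_const (s ^ 2)
    have hdiv := hl.fun_div hd (by positivity)
    refine (((hdiv.const_mul C).add
      ((hasDerivAt_arctan_linear_div (C := C) hs B t).const_mul (C / s))).const_mul
        (1 / s ^ 2)).congr_deriv ?_
    rw [hq]
    generalize hP : A + 2 * B * t + C * t ^ 2 = P at *
    field_simp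
    linear_combination (-2) * hq
  · intro t _
    positivity
  · refine Tendsto.const_mul _ (Tendsto.add (Tendsto.const_mul _ ?_) (Tendsto.const_mul _ ?_))
    · exact (tendsto_div_sq_add_sq_atTop s).comp hlin
    · exact (tendsto_nhds_of_tendsto_nhdsWithin tendsto_arctan_atTop).comp
        (hlin.atTop_div_const hs)

theorem lintegral_inv_quadratic_sq {A B C s : ℝ} (hC : 0 < C) (hs : 0 < s)
    (h : A * C - B ^ 2 = s ^ 2) :
    ∫⁻ t : ℝ, ENNReal.ofReal (2 / (A + 2 * B * t + C * t ^ 2) ^ 2) =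
      ENNReal.ofReal (C * π / s ^ 3) := by
  have hA : 0 < A := by simpa using quadratic_pos hC hs h 0
  have hpos := lintegral_Ioi_inv_quadratic_sq hC hs h
  have hpos' := lintegral_Ioi_inv_quadratic_sq (A := A) (B := -B) hC hs (by linarith)
  have hneg : ∫⁻ t in Iic (0 : ℝ), ENNReal.ofReal (2 / (A + 2 * B * t + C * t ^ 2) ^ 2) =
      ∫⁻ t in Ioi (0 : ℝ), ENNReal.ofReal (2 / (A + 2 * (-B) * t + C * t ^ 2) ^ 2) := by
    have := (Measure.measurePreserving_neg (volume : Measure ℝ)).setLIntegral_comp_preimage_emb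
      (MeasurableEquiv.neg ℝ).measurableEmbedding
      (fun t => ENNReal.ofReal (2 / (A + 2 * B * t + C * t ^ 2) ^ 2)) (Iic 0)
    rw [← this]
    simp only [Set.neg_preimage, Set.neg_Iic, neg_zero]
    rw [setLIntegral_congr Ioi_ae_eq_Ici.symm]
    refine lintegral_congr fun t => ?_
    congr 3
    ring
  rw [← lintegral_add_compl _ (measurableSet_Ioi (a := (0 : ℝ))), compl_Ioi, hneg,
    hpos.2, hpos'.2, ← ENNReal.ofReal_add hpos.1 hpos'.1]
  congr 1
  rw [neg_div s B, arctan_neg, neg_sq]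
  ring

theorem lintegral_Ioi_div_quadratic_sq {A B C s : ℝ} (hC : 0 < C) (hs : 0 < s)
    (h : A * C - B ^ 2 = s ^ 2) :
    0 ≤ 1 / s ^ 2 * (1 - B / s * (π / 2 - arctan (B / s))) ∧
    ∫⁻ t in Ioi (0 : ℝ), ENNReal.ofReal (t * (2 / (A + 2 * B * t + C * t ^ 2) ^ 2)) =
      ENNReal.ofReal (1 / s ^ 2 * (1 - B / s * (π / 2 - arctan (B / s)))) := by
  have hlin := tendsto_linear_atTop hC B
  have key := lintegral_Ioi_of_hasDerivAt_of_nonneg (a := 0)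
    (g := fun t => -(1 / s ^ 2) * (B * ((C * t + B) / ((C * t + B) ^ 2 + s ^ 2)) +
      s ^ 2 * (1 / ((C * t + B) ^ 2 + s ^ 2)) + B / s * arctan ((C * t + B) / s)))
    (g' := fun t => t * (2 / (A + 2 * B * t + C * t ^ 2) ^ 2))
    (l := -(1 / s ^ 2) * (B * 0 + s ^ 2 * 0 + B / s * (π / 2))) ?_ ?_ ?_
  · have hB : B ^ 2 + s ^ 2 ≠ 0 := by positivity
    convert key using 2
    all_goals simp only [mul_zero, zero_add]
    on_goal 2 => congr 1
    all_goals
      field_simp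
      ring
  · intro t _
    have hp := quadratic_pos hC hs h t
    have hl : HasDerivAt (fun t : ℝ => C * t + B) C t := by
      simpa using ((hasDerivAt_id t).const_mul C).add_const B
    have hq : (C * t + B) ^ 2 + s ^ 2 = C * (A + 2 * B * t + C * t ^ 2) := by
      linear_combination -h
    have hd : HasDerivAt (fun t : ℝ => (C * t + B) ^ 2 + s ^ 2) (2 * (C * t + B) * C) t := by
      simpa using (hl.pow 2).add_const (s ^ 2)
    have hdiv := hl.fun_div hd (by positivity)
    have hinv := (hasDerivAt_const t (1 : ℝ)).fun_div hd (by positivity)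
    refine ((((hdiv.const_mul B).add (hinv.const_mul (s ^ 2))).add
      ((hasDerivAt_arctan_linear_div (C := C) hs B t).const_mul (B / s))).const_mul
        (-(1 / s ^ 2))).congr_deriv ?_
    rw [hq]
    generalize hP : A + 2 * B * t + C * t ^ 2 = P at *
    field_simp
    linear_combination (2 * B) * hq
  · intro t ht
    have : 0 < t := ht
    positivity
  · refine Tendsto.const_mul _ (Tendsto.add (Tendsto.add (Tendsto.const_mul _ ?_)
      (Tendsto.const_mul _ ?_)) (Tendsto.const_mul _ ?_))
    · exact (tendsto_div_sq_add_sq_atTop s).comp hlin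
    · exact (tendsto_inv_sq_add_sq_atTop s).comp hlin
    · exact (tendsto_nhds_of_tendsto_nhdsWithin tendsto_arctan_atTop).comp
        (hlin.atTop_div_const hs)

theorem lintegral_Ioi_cube_mul_exp_neg_mul_sq {p : ℝ} (hp : 0 < p) :
    ∫⁻ x in Ioi (0 : ℝ), ENNReal.ofReal (x ^ 3 * exp (-(p * x ^ 2) / 2)) =
      ENNReal.ofReal (2 / p ^ 2) := by
  have h1 : ∀ x : ℝ, x ^ 3 * exp (-(p * x ^ 2) / 2) =
      x ^ (3 : ℝ) * exp (-(p / 2) * x ^ (2 : ℝ)) := by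
    intro x
    rw [show (3 : ℝ) = (3 : ℕ) by norm_num, show x ^ (2 : ℝ) = x ^ 2 from rpow_natCast x 2,
      rpow_natCast]
    congr 2
    ring
  have hint : IntegrableOn (fun x : ℝ => x ^ (3 : ℝ) * exp (-(p / 2) * x ^ (2 : ℝ))) (Ioi 0) := by
    simpa using integrableOn_rpow_mul_exp_neg_mul_sq (half_pos hp) (s := 3) (by norm_num)
  simp_rw [h1]
  rw [← ofReal_integral_eq_lintegral_ofReal hint,
    integral_rpow_mul_exp_neg_mul_rpow two_pos (by norm_num) (half_pos hp)]
  · congr 1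
    rw [show -((3 : ℝ) + 1) / 2 = -(2 : ℕ) by norm_num,
      show ((3 : ℝ) + 1) / 2 = (1 : ℕ) + 1 by norm_num,
      Gamma_nat_eq_factorial, rpow_neg (half_pos hp).le, rpow_natCast]
    norm_num
    field_simp
  · refine (ae_restrict_iff' measurableSet_Ioi).2 (Eventually.of_forall fun x hx => ?_)
    have : (0 : ℝ) < x := hx
    simp only [Pi.zero_apply]
    positivity

/-- Integration in projective coordinates `(x, y) = (x, x t)` of a positively homogeneous function
of degree two on a half plane against a Gaussian weight. -/
theorem lintegral_homogeneous_mul_exp {A B C s : ℝ} (hC : 0 < C) (hs : 0 < s)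
    (h : A * C - B ^ 2 = s ^ 2) {F : ℝ → ℝ → ℝ} {g : ℝ → ℝ} (hg : Measurable g)
    (hg0 : ∀ t, 0 ≤ g t) (hF0 : ∀ x ≤ 0, ∀ y, F x y = 0)
    (hF : ∀ x > 0, ∀ t, F x (x * t) = x ^ 2 * g t) :
    ∫⁻ x : ℝ, ∫⁻ y : ℝ,
        ENNReal.ofReal (F x y * exp (-(A * x ^ 2 + 2 * B * x * y + C * y ^ 2) / 2)) =
      ∫⁻ t : ℝ, ENNReal.ofReal (g t * (2 / (A + 2 * B * t + C * t ^ 2) ^ 2)) := by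
  have hscale : ∀ x ∈ Ioi (0 : ℝ), ∫⁻ y : ℝ,
        ENNReal.ofReal (F x y * exp (-(A * x ^ 2 + 2 * B * x * y + C * y ^ 2) / 2)) =
      ∫⁻ t : ℝ, ENNReal.ofReal (g t) *
        ENNReal.ofReal (x ^ 3 * exp (-((A + 2 * B * t + C * t ^ 2) * x ^ 2) / 2)) := by
    intro x hx
    have hx : 0 < x := hx
    conv_lhs => rw [← Real.smul_map_volume_mul_left hx.ne']
    rw [lintegral_smul_measure,
      (measurableEmbedding_mulLeft₀ hx.ne').lintegral_map, smul_eq_mul,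
      ← lintegral_const_mul' _ _ ENNReal.ofReal_ne_top]
    refine lintegral_congr fun t => ?_
    rw [← ENNReal.ofReal_mul (abs_nonneg _), ← ENNReal.ofReal_mul (hg0 t), abs_of_pos hx]
    congr 1
    rw [hF x hx, show A * x ^ 2 + 2 * B * x * (x * t) + C * (x * t) ^ 2 =
      (A + 2 * B * t + C * t ^ 2) * x ^ 2 by ring]
    ring
  have hleft : ∫⁻ x in (Ioi (0 : ℝ))ᶜ, ∫⁻ y : ℝ,
      ENNReal.ofReal (F x y * exp (-(A * x ^ 2 + 2 * B * x * y + C * y ^ 2) / 2)) = 0 := by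
    rw [setLIntegral_congr_fun (g := fun _ => 0) measurableSet_Ioi.compl]
    · simp
    · intro x hx
      simp [hF0 x (by simpa using hx)]
  rw [← lintegral_add_compl _ (measurableSet_Ioi (a := (0 : ℝ))), hleft, add_zero,
    setLIntegral_congr_fun measurableSet_Ioi hscale, lintegral_lintegral_swap (by fun_prop)]
  refine lintegral_congr fun t => ?_
  rw [lintegral_const_mul' _ _ ENNReal.ofReal_ne_top,
    lintegral_Ioi_cube_mul_exp_neg_mul_sq (quadratic_pos hC hs h t), ENNReal.ofReal_mul (hg0 t)]

theorem integral_gaussianOfCov {a c k r : ℝ} (hr : 0 < r) (h : a * c - k ^ 2 = r ^ 2)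
    {F : ℝ → ℝ → ℝ} (hF : Measurable (Function.uncurry F)) (hF0 : ∀ x y, 0 ≤ F x y) :
    ∫ z, F (z 0) (z 1) ∂(gaussianOfCov !![a, k; k, c]) =
      (2 * π * r)⁻¹ * (∫⁻ x : ℝ, ∫⁻ y : ℝ, ENNReal.ofReal (F x y *
        exp (-(c / r ^ 2 * x ^ 2 + 2 * (-k / r ^ 2) * x * y + a / r ^ 2 * y ^ 2) / 2))).toReal := by
  have hdet : (!![a, k; k, c]).det = r ^ 2 := by
    rw [det_fin_two_of, ← h]
    ring
  have hquad : ∀ z : Fin 2 → ℝ, z ⬝ᵥ ((!![a, k; k, c])⁻¹ *ᵥ z) =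
      c / r ^ 2 * z 0 ^ 2 + 2 * (-k / r ^ 2) * z 0 * z 1 + a / r ^ 2 * z 1 ^ 2 := by
    intro z
    rw [inv_def, hdet, Ring.inverse_eq_inv', adjugate_fin_two_of]
    simp [dotProduct, mulVec, Fin.sum_univ_two]
    ring
  have hmeas : Measurable fun z : Fin 2 → ℝ => F (z 0) (z 1) :=
    hF.comp (f := fun z : Fin 2 → ℝ => (z 0, z 1)) (by fun_prop)
  have hmeas' : Measurable fun p : ℝ × ℝ => F p.1 p.2 := hF
  rw [integral_eq_lintegral_of_nonneg_ae (Eventually.of_forall fun z => hF0 _ _)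
    hmeas.aestronglyMeasurable, gaussianOfCov]
  simp_rw [hquad, hdet, sqrt_sq hr.le]
  rw [lintegral_withDensity_eq_lintegral_mul _ (by fun_prop) (by fun_prop)]
  have hsplit : ∀ z : Fin 2 → ℝ, ENNReal.ofReal ((2 * π * r)⁻¹ * exp (-(c / r ^ 2 * z 0 ^ 2 +
        2 * (-k / r ^ 2) * z 0 * z 1 + a / r ^ 2 * z 1 ^ 2) / 2)) *
        ENNReal.ofReal (F (z 0) (z 1)) =
      ENNReal.ofReal (2 * π * r)⁻¹ * ENNReal.ofReal (F (z 0) (z 1) * exp (-(c / r ^ 2 * z 0 ^ 2 +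
        2 * (-k / r ^ 2) * z 0 * z 1 + a / r ^ 2 * z 1 ^ 2) / 2)) := by
    intro z
    rw [← ENNReal.ofReal_mul (by positivity), ← ENNReal.ofReal_mul (by positivity)]
    congr 1
    ring
  simp_rw [Pi.mul_apply, hsplit]
  rw [lintegral_const_mul' _ _ ENNReal.ofReal_ne_top, ENNReal.toReal_mul,
    ENNReal.toReal_ofReal (by positivity)]
  have hprod := (volume_preserving_finTwoArrow ℝ).lintegral_comp_emb
    (MeasurableEquiv.measurableEmbedding _)
    (fun p : ℝ × ℝ => ENNReal.ofReal (F p.1 p.2 * exp (-(c / r ^ 2 * p.1 ^ 2 +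
        2 * (-k / r ^ 2) * p.1 * p.2 + a / r ^ 2 * p.2 ^ 2) / 2)))
  simp only [MeasurableEquiv.finTwoArrow_apply] at hprod
  rw [hprod, Measure.volume_eq_prod, lintegral_prod _ (by fun_prop)]

theorem inverse_det_eq {a c k r : ℝ} (hr : 0 < r) (h : a * c - k ^ 2 = r ^ 2) :
    c / r ^ 2 * (a / r ^ 2) - (-k / r ^ 2) ^ 2 = (1 / r) ^ 2 := by
  field_simp
  linear_combination h

theorem reluMoment_zero_zero {a c k r : ℝ} (ha : 0 < a) (hr : 0 < r)
    (h : a * c - k ^ 2 = r ^ 2) : reluMoment !![a, k; k, c] 0 0 = a / 2 := by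
  rw [reluMoment, of_apply, integral_gaussianOfCov hr h (F := fun x _ => max x 0 * max x 0)
    (by fun_prop) (fun x y => by positivity),
    lintegral_homogeneous_mul_exp (g := fun _ => 1) (by positivity) (one_div_pos.2 hr)
      (inverse_det_eq hr h) measurable_const (fun _ => zero_le_one)
      (fun x hx y => by simp [hx]) (fun x hx t => by rw [max_eq_left hx.le]; ring)]
  simp_rw [one_mul]
  rw [lintegral_inv_quadratic_sq (by positivity) (one_div_pos.2 hr) (inverse_det_eq hr h),
    ENNReal.toReal_ofReal (by positivity)]
  field_simp

theorem reluMoment_one_one {a c k r : ℝ} (hc : 0 < c) (hr : 0 < r)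
    (h : a * c - k ^ 2 = r ^ 2) : reluMoment !![a, k; k, c] 1 1 = c / 2 := by
  have h' : c * a - k ^ 2 = r ^ 2 := by linarith
  rw [← reluMoment_zero_zero hc hr h', reluMoment, of_apply,
    integral_gaussianOfCov hr h (F := fun _ y => max y 0 * max y 0)
      (by fun_prop) (fun x y => by positivity),
    reluMoment, of_apply, integral_gaussianOfCov hr h' (F := fun x _ => max x 0 * max x 0)
      (by fun_prop) (fun x y => by positivity), lintegral_lintegral_swap (by fun_prop)]
  congr 2
  refine lintegral_congr fun x => lintegral_congr fun y => ?_
  congr 3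
  ring

theorem reluMoment_zero_one {a c k r : ℝ} (ha : 0 < a) (hr : 0 < r)
    (h : a * c - k ^ 2 = r ^ 2) :
    reluMoment !![a, k; k, c] 0 1 = (2 * π)⁻¹ * (r + k * (π / 2 + arctan (k / r))) := by
  rw [reluMoment, of_apply, integral_gaussianOfCov hr h (F := fun x y => max x 0 * max y 0)
    (by fun_prop) (fun x y => by positivity),
    lintegral_homogeneous_mul_exp (g := fun t => max t 0) (by positivity) (one_div_pos.2 hr)
      (inverse_det_eq hr h) (by fun_prop) (fun _ => le_max_right _ _)
      (fun x hx y => by simp [hx]) ?_]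
  · have hleft : ∫⁻ t in (Ioi (0 : ℝ))ᶜ, ENNReal.ofReal (max t 0 *
        (2 / (c / r ^ 2 + 2 * (-k / r ^ 2) * t + a / r ^ 2 * t ^ 2) ^ 2)) = 0 := by
      rw [setLIntegral_congr_fun (g := fun _ => 0) measurableSet_Ioi.compl]
      · simp
      · intro t ht
        simp [max_eq_right (show t ≤ 0 by simpa using ht)]
    have hright : ∫⁻ t in Ioi (0 : ℝ), ENNReal.ofReal (max t 0 *
        (2 / (c / r ^ 2 + 2 * (-k / r ^ 2) * t + a / r ^ 2 * t ^ 2) ^ 2)) =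
        ∫⁻ t in Ioi (0 : ℝ), ENNReal.ofReal (t *
        (2 / (c / r ^ 2 + 2 * (-k / r ^ 2) * t + a / r ^ 2 * t ^ 2) ^ 2)) :=
      setLIntegral_congr_fun measurableSet_Ioi fun t ht => by
        simp only [max_eq_left (le_of_lt (show 0 < t from ht))]
    obtain ⟨hnonneg, hval⟩ := lintegral_Ioi_div_quadratic_sq (C := a / r ^ 2) (by positivity)
      (one_div_pos.2 hr) (inverse_det_eq hr h)
    rw [← lintegral_add_compl _ (measurableSet_Ioi (a := (0 : ℝ))), hleft, add_zero, hright,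
      hval, ENNReal.toReal_ofReal hnonneg,
      show -k / r ^ 2 / (1 / r) = -(k / r) by field_simp, arctan_neg]
    field_simp
    ring
  · intro x hx t
    have hmax : max (x * t) 0 = x * max t 0 := by rw [mul_max_of_nonneg _ _ hx.le, mul_zero]
    rw [max_eq_left hx.le, hmax]
    ring

theorem reluMoment_comm (K : Matrix (Fin 2) (Fin 2) ℝ) (i j : Fin 2) :
    reluMoment K i j = reluMoment K j i := by
  simp only [reluMoment, of_apply, mul_comm]

theorem arctan_le_of_nonneg {u : ℝ} (hu : 0 ≤ u) : arctan u ≤ u := by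
  simpa [tan_arctan] using le_tan (arctan_nonneg.2 hu) (arctan_lt_pi_div_two u)

theorem arctan_one_add_div_one_sub_le {u : ℝ} (hu : 0 ≤ u) (hu1 : u < 1) :
    arctan ((1 + u) / (1 - u)) ≤ π / 4 + u := by
  have := arctan_add (x := 1) (y := u) (by linarith)
  rw [arctan_one, one_mul] at this
  rw [← this]
  gcongr
  exact arctan_le_of_nonneg hu

theorem le_arctan_one_sub_div_one_add {u : ℝ} (hu : 0 ≤ u) :
    π / 4 - u ≤ arctan ((1 - u) / (1 + u)) := by
  have := arctan_add (x := 1) (y := -u) (by linarith)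
  rw [arctan_one, one_mul, arctan_neg, sub_neg_eq_add, ← sub_eq_add_neg, ← sub_eq_add_neg] at this
  rw [← this]
  gcongr
  exact arctan_le_of_nonneg hu

theorem posDef_fin_two {a c k : ℝ} (ha : 0 < a) (h : 0 < a * c - k ^ 2) :
    (!![a, k; k, c]).PosDef := by
  refine PosDef.of_dotProduct_mulVec_pos (by ext i j; fin_cases i <;> fin_cases j <;> simp) ?_
  intro x hx
  have hexp : star x ⬝ᵥ (!![a, k; k, c] *ᵥ x) =
      a * x 0 ^ 2 + 2 * k * x 0 * x 1 + c * x 1 ^ 2 := by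
    simp [dotProduct, mulVec, Fin.sum_univ_two]
    ring
  rw [hexp]
  have hmul : a * (a * x 0 ^ 2 + 2 * k * x 0 * x 1 + c * x 1 ^ 2) =
      (a * x 0 + k * x 1) ^ 2 + (a * c - k ^ 2) * x 1 ^ 2 := by ring
  refine pos_of_mul_pos_right (a := a) ?_ ha.le
  rw [hmul]
  by_cases h1 : x 1 = 0
  · have h0 : x 0 ≠ 0 := fun h0 => hx (by ext i; fin_cases i <;> simp [h0, h1])
    rw [h1]
    simp only [mul_zero, add_zero]
    positivity
  · positivity

/-- Counterexample of Section D: `K₁ ⪰ K₂` (both SPD) does not imply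
`C₁ ⪰ C₂` for the ReLU post-activation second raw moments. -/
theorem relu_moment_not_loewner_monotone :
    (!![(2.58 : ℝ), 0.83; 0.83, 0.62]).PosDef ∧
    (!![(1.52 : ℝ), 0.76; 0.76, 0.61]).PosDef ∧
    (!![(2.58 : ℝ), 0.83; 0.83, 0.62] - !![(1.52 : ℝ), 0.76; 0.76, 0.61]).PosSemidef ∧
    ¬ (reluMoment !![(2.58 : ℝ), 0.83; 0.83, 0.62]
        - reluMoment !![(1.52 : ℝ), 0.76; 0.76, 0.61]).PosSemidef := by
  refine ⟨posDef_fin_two (by norm_num) (by norm_num), posDef_fin_two (by norm_num) (by norm_num),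
    ?_, ?_⟩
  · have hsub : !![(2.58 : ℝ), 0.83; 0.83, 0.62] - !![(1.52 : ℝ), 0.76; 0.76, 0.61] =
        !![(1.06 : ℝ), 0.07; 0.07, 0.01] := by
      ext i j
      fin_cases i <;> fin_cases j <;> norm_num
    rw [hsub]
    exact (posDef_fin_two (by norm_num) (by norm_num)).posSemidef
  · intro hpsd
    have hdet := hpsd.det_nonneg
    obtain ⟨r₁, hr₁, h₁⟩ : ∃ r : ℝ, 0 < r ∧ r ^ 2 = 0.9107 :=
      ⟨√0.9107, by positivity, sq_sqrt (by norm_num)⟩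
    obtain ⟨r₂, hr₂, h₂⟩ : ∃ r : ℝ, 0 < r ∧ r ^ 2 = 0.3496 :=
      ⟨√0.3496, by positivity, sq_sqrt (by norm_num)⟩
    have hd₁ : (2.58 : ℝ) * 0.62 - 0.83 ^ 2 = r₁ ^ 2 := by rw [h₁]; norm_num
    have hd₂ : (1.52 : ℝ) * 0.61 - 0.76 ^ 2 = r₂ ^ 2 := by rw [h₂]; norm_num
    rw [det_fin_two] at hdet
    simp only [Matrix.sub_apply] at hdet
    rw [reluMoment_comm _ 1 0, reluMoment_comm _ 1 0,
      reluMoment_zero_zero (by norm_num) hr₁ hd₁, reluMoment_zero_zero (by norm_num) hr₂ hd₂,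
      reluMoment_one_one (by norm_num) hr₁ hd₁, reluMoment_one_one (by norm_num) hr₂ hd₂,
      reluMoment_zero_one (by norm_num) hr₁ hd₁, reluMoment_zero_one (by norm_num) hr₂ hd₂,
      ← mul_sub] at hdet
    have hr₁l : 0.954 < r₁ := lt_of_pow_lt_pow_left₀ 2 hr₁.le (by rw [h₁]; norm_num)
    have hr₁u : r₁ < 0.9544 := lt_of_pow_lt_pow_left₀ 2 (by norm_num) (by rw [h₁]; norm_num)
    have hr₂l : 0.591 < r₂ := lt_of_pow_lt_pow_left₀ 2 hr₂.le (by rw [h₂]; norm_num)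
    have hr₂u : r₂ < 0.592 := lt_of_pow_lt_pow_left₀ 2 (by norm_num) (by rw [h₂]; norm_num)
    have hat₁ : π / 4 - 0.07 ≤ arctan (0.83 / r₁) := by
      refine (le_arctan_one_sub_div_one_add (by norm_num)).trans (arctan_mono ?_)
      rw [le_div_iff₀ hr₁]
      linarith
    have hat₂ : arctan (0.76 / r₂) ≤ π / 4 + 0.126 := by
      refine (arctan_mono ?_).trans (arctan_one_add_div_one_sub_le (by norm_num) (by norm_num))
      rw [div_le_iff₀ hr₂]
      linarith
    have hlow : 0.0515 < (2 * π)⁻¹ * (r₁ + 0.83 * (π / 2 + arctan (0.83 / r₁)) -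
        (r₂ + 0.76 * (π / 2 + arctan (0.76 / r₂)))) := by
      rw [inv_mul_eq_div, lt_div_iff₀ (by positivity)]
      linarith [pi_gt_d2, pi_lt_d2]
    nlinarith
end
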